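/- For every integer r with 0 ≤ r ≤ q + 1, f(r) = r(q + 2 − r). -/

import Mathlib

open scoped BigOperators

/-- Points (and, by self-duality of homogeneous coordinates, lines) of the
Desarguesian projective plane `PG(2,q)` over the field `F`. -/
abbrev PG (F : Type*) [Field F] := Projectivization F (Fin 3 → F)

/-- Incidence between a point and a line (the line being given by its dual
homogeneous coordinates): the dot product of representatives vanishes.
This does not depend on the choice of representatives. -/
def Incid {F : Type*} [Field F] (p l : PG F) : Prop :=
  ∑ i, p.rep i * l.rep i = 0

/-- `𝒫ᵒ(R)`: points incident with an odd number of lines of `R`. -/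
def Podd (F : Type*) [Field F] (R : Set (PG F)) : Set (PG F) :=
  {p | Odd {l ∈ R | Incid p l}.ncard}

/-- `𝒫ᵉ(R)`: points incident with an even number of lines of `R`. -/
def Peven (F : Type*) [Field F] (R : Set (PG F)) : Set (PG F) :=
  {p | Even {l ∈ R | Incid p l}.ncard}

/-- `ℒᵒ(S)`: lines meeting `S` in an odd number of points. -/
def Lodd (F : Type*) [Field F] (S : Set (PG F)) : Set (PG F) :=
  {l | Odd {p ∈ S | Incid p l}.ncard}

/-- `ℒᵉ(S)`: lines meeting `S` in an even number of points. -/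
def Leven (F : Type*) [Field F] (S : Set (PG F)) : Set (PG F) :=
  {l | Even {p ∈ S | Incid p l}.ncard}

/-- `f(r)`: the minimum size of the symmetric difference of `r` distinct lines,
i.e. the minimum of `|𝒫ᵒ(R)|` over sets `R` of exactly `r` lines. -/
noncomputable def fmin (F : Type*) [Field F] (r : ℕ) : ℕ :=
  sInf {n | ∃ R : Set (PG F), R.ncard = r ∧ (Podd F R).ncard = n}

open Classical in
theorem aux_incid_iff {F : Type*} [Field F] (p l : PG F) :
    Incid p l ↔ Projectivization.orthogonal p l := by
  conv_rhs => rw [← p.mk_rep, ← l.mk_rep]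
  rw [Projectivization.orthogonal_mk]
  rfl

open Classical in
theorem aux_inter {F : Type*} [Field F] [Fintype F] [Fintype (PG F)] (l m : PG F) :
    ((Finset.univ.filter (fun p : PG F => Incid p l ∧ Incid p m)).card : ℤ)
      = 1 + if l = m then (Fintype.card F : ℤ) else 0 := by
  split_ifs with h
  · subst h
    have h1 := Configuration.ProjectivePlane.card_points (PG F) (PG F)
    have h2 := Projectivization.card_of_finrank F (Fin 3 → F) (n := 3) (by simp)
    have h3 := Configuration.ProjectivePlane.pointCount_eq (PG F) l
    rw [Nat.card_eq_fintype_card, h1, Nat.card_eq_fintype_card] at h2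
    simp only [Finset.sum_range_succ, Finset.sum_range_zero] at h2
    have h4 : Configuration.ProjectivePlane.order (PG F) (PG F) = Fintype.card F := by
      nlinarith
    rw [h4, Configuration.pointCount, Nat.card_eq_fintype_card, Fintype.card_subtype] at h3
    have h5 : (Finset.univ.filter (fun p : PG F => Incid p l ∧ Incid p l))
        = Finset.univ.filter (fun p : PG F => p ∈ l) := by
      ext p
      simp [aux_incid_iff, Configuration.ofField.mem_iff]
    rw [h5, h3]
    push_cast
    ring
  · have : (Finset.univ.filter (fun p : PG F => Incid p l ∧ Incid p m)).card = 1 := by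
      rw [Finset.card_eq_one]
      refine ⟨Projectivization.cross l m, ?_⟩
      ext p
      simp only [Finset.mem_filter, Finset.mem_univ, true_and, Finset.mem_singleton, aux_incid_iff]
      have hl := Projectivization.cross_orthogonal_left h
      have hm := Projectivization.cross_orthogonal_right h
      constructor
      · rintro ⟨h1, h2⟩
        exact (Configuration.ofField.eq_or_eq_of_orthogonal h1 hl h2 hm).resolve_right h
      · rintro rfl
        exact ⟨hl, hm⟩
    rw [this]; simp

open Classical in
theorem aux_count {F : Type*} [Field F] [Fintype F] [Fintype (PG F)] (R : Finset (PG F)) :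
    ∑ p : PG F, ((R.filter (Incid p)).card : ℤ) * (2 - ((R.filter (Incid p)).card : ℤ))
      = R.card * (Fintype.card F + 2 - R.card) := by
  have e : ∀ p : PG F, ((R.filter (Incid p)).card : ℤ) = ∑ l ∈ R, if Incid p l then 1 else 0 := by
    intro p; simp
  have s1 : ∑ p : PG F, ((R.filter (Incid p)).card : ℤ) = R.card * (Fintype.card F + 1) := by
    simp_rw [e]
    rw [Finset.sum_comm]
    have : ∀ l ∈ R, (∑ p : PG F, if Incid p l then (1:ℤ) else 0) = Fintype.card F + 1 := by
      intro l _
      have := aux_inter l l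
      simp only [and_self, if_true] at this
      rw [Finset.sum_boole, this]; ring
    rw [Finset.sum_congr rfl this]; simp
  have s2 : ∑ p : PG F, ((R.filter (Incid p)).card : ℤ) * ((R.filter (Incid p)).card : ℤ)
      = R.card * (Fintype.card F + R.card) := by
    simp_rw [e, Finset.sum_mul_sum]
    rw [Finset.sum_comm]
    have : ∀ l ∈ R, (∑ p : PG F, ∑ m ∈ R, (if Incid p l then (1:ℤ) else 0) *
        (if Incid p m then 1 else 0)) = Fintype.card F + R.card := by
      intro l hl
      rw [Finset.sum_comm]
      have h2 : ∀ m ∈ R, (∑ p : PG F, (if Incid p l then (1:ℤ) else 0) *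
        (if Incid p m then 1 else 0)) = 1 + if l = m then (Fintype.card F : ℤ) else 0 := by
        intro m _
        rw [← aux_inter l m, ← Finset.sum_boole]
        refine Finset.sum_congr rfl fun p _ => ?_
        by_cases h1 : Incid p l <;> by_cases h2 : Incid p m <;> simp [h1, h2]
      rw [Finset.sum_congr rfl h2, Finset.sum_add_distrib]
      simp [hl]; ring
    rw [Finset.sum_congr rfl this]; simp
  simp_rw [mul_sub, Finset.sum_sub_distrib, ← Finset.sum_mul]
  rw [s1, s2]; ring

open Classical in
theorem aux_podd {F : Type*} [Field F] [Fintype F] [Fintype (PG F)] (R : Finset (PG F)) :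
    ((Podd F (R : Set (PG F))).ncard : ℤ)
      = ∑ p : PG F, if Odd (R.filter (Incid p)).card then (1:ℤ) else 0 := by
  rw [Finset.sum_boole]
  congr 1
  rw [← Set.ncard_coe_finset]
  congr 1
  ext p
  simp only [Podd, Set.mem_setOf_eq, Finset.coe_filter, Finset.mem_univ, true_and]
  rw [← Set.ncard_coe_finset (R.filter (Incid p))]
  simp

open Classical in
theorem aux_lower {F : Type*} [Field F] [Fintype F] [Fintype (PG F)] (R : Finset (PG F)) :
    (R.card * (Fintype.card F + 2 - R.card) : ℤ) ≤ (Podd F (R : Set (PG F))).ncard := by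
  rw [aux_podd, ← aux_count]
  refine Finset.sum_le_sum fun p _ => ?_
  generalize (R.filter (Incid p)).card = n
  rcases Nat.lt_or_ge n 2 with h | h
  · interval_cases n <;> simp
  · have : (n : ℤ) * (2 - n) ≤ 0 := by
      have : (2 : ℤ) ≤ n := by exact_mod_cast h
      nlinarith
    split_ifs <;> linarith

open Classical in
theorem aux_eq {F : Type*} [Field F] [Fintype F] [Fintype (PG F)] (R : Finset (PG F))
    (hR : ∀ p, (R.filter (Incid p)).card ≤ 2) :
    (R.card * (Fintype.card F + 2 - R.card) : ℤ) = (Podd F (R : Set (PG F))).ncard := by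
  rw [aux_podd, ← aux_count]
  refine Finset.sum_congr rfl fun p _ => ?_
  have := hR p
  generalize (R.filter (Incid p)).card = n at this
  interval_cases n <;> simp [Nat.odd_iff]

/-- coordinate vectors of the dual conic -/
def conicVec {F : Type*} [Field F] : Option F → Fin 3 → F
  | none => ![0, 0, 1]
  | some t => ![1, t, t ^ 2]

theorem conicVec_ne {F : Type*} [Field F] (x : Option F) : conicVec x ≠ 0 := by
  intro h
  rcases x with _ | t
  · simpa [conicVec] using congrFun h 2
  · simpa [conicVec] using congrFun h 0

/-- lines of the dual conic -/
def conicPt {F : Type*} [Field F] (x : Option F) : PG F :=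
  Projectivization.mk F (conicVec x) (conicVec_ne x)

theorem conicPt_inj {F : Type*} [Field F] : Function.Injective (conicPt (F := F)) := by
  intro x y h
  rw [conicPt, conicPt, Projectivization.mk_eq_mk_iff'] at h
  obtain ⟨a, h⟩ := h
  have h0 := congrFun h 0
  have h1 := congrFun h 1
  have h2 := congrFun h 2
  rcases x with _ | s <;> rcases y with _ | t <;> simp [conicVec] at h0 h1 h2 ⊢
  · simp [h0] at h2
  · subst h0; simpa using h1.symm

theorem conic_incid {F : Type*} [Field F] (p : PG F) (x : Option F) :
    Incid p (conicPt x) ↔ ∑ i, p.rep i * conicVec x i = 0 := by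
  rw [aux_incid_iff, conicPt]
  conv_lhs => rw [← p.mk_rep]
  rw [Projectivization.orthogonal_mk]
  rfl

theorem quad_two {F : Type*} [Field F] {a b c s t : F} (hst : s ≠ t)
    (hs : a + b * s + c * s ^ 2 = 0) (ht : a + b * t + c * t ^ 2 = 0) :
    b + c * (s + t) = 0 := by
  have : (s - t) * (b + c * (s + t)) = 0 := by linear_combination hs - ht
  exact (mul_eq_zero.mp this).resolve_left (sub_ne_zero.mpr hst)

theorem conic_arc {F : Type*} [Field F] (p : PG F) (x y z : Option F)
    (hxy : x ≠ y) (hxz : x ≠ z) (hyz : y ≠ z)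
    (hx : Incid p (conicPt x)) (hy : Incid p (conicPt y)) (hz : Incid p (conicPt z)) : False := by
  rw [conic_incid] at hx hy hz
  have hp := p.rep_nonzero
  generalize p.rep = v at *
  have key2 : ∀ s t : F, s ≠ t → v 2 = 0 → v 0 + v 1 * s + v 2 * s ^ 2 = 0 →
      v 0 + v 1 * t + v 2 * t ^ 2 = 0 → False := by
    intro s t hst h2 hs ht
    have h1 := quad_two hst hs ht
    have h1' : v 1 = 0 := by simpa [h2] using h1
    have h0 : v 0 = 0 := by simpa [h2, h1'] using hs
    apply hp
    ext i
    fin_cases i <;> simp [h0, h1', h2]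
  rcases x with _ | s <;> rcases y with _ | t <;> rcases z with _ | u <;>
    simp [conicVec, Fin.sum_univ_three] at hx hy hz hxy hxz hyz
  · exact key2 t u hyz hx hy hz
  · exact key2 s u hxz hy hx hz
  · exact key2 s t hxy hz hx hy
  · have h1 := quad_two hxy hx hy
    have h2 := quad_two hxz hx hz
    have h3 : (t - u) * v 2 = 0 := by linear_combination h1 - h2
    exact key2 s t hxy ((mul_eq_zero.mp h3).resolve_left (sub_ne_zero.mpr hyz)) hx hy

/-- For `0 ≤ r ≤ q + 1`, `f(r) = r(q + 2 − r)`. -/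
theorem stmt4 {F : Type*} [Field F] [Fintype F] (q : ℕ)
    (hcard : Fintype.card F = q) (hq : Odd q)
    (r : ℕ) (hr : r ≤ q + 1) :
    fmin F r = r * (q + 2 - r) := by
  classical
  have : Fintype (PG F) := Fintype.ofFinite _
  have cast : ((r * (q + 2 - r) : ℕ) : ℤ) = r * (q + 2 - r) := by
    rw [Nat.cast_mul, Nat.cast_sub (by omega)]; push_cast; ring
  have hmem : r * (q + 2 - r) ∈
      {n | ∃ R : Set (PG F), R.ncard = r ∧ (Podd F R).ncard = n} := by
    obtain ⟨T, -, hT⟩ := Finset.exists_subset_card_eq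
      (s := (Finset.univ : Finset (Option F))) (n := r) (by simp [hcard, hr])
    have hc : (T.image conicPt).card = r := by
      rw [Finset.card_image_of_injective _ conicPt_inj, hT]
    refine ⟨(T.image conicPt : Finset (PG F)), ?_, ?_⟩
    · rw [Set.ncard_coe_finset, hc]
    · have := aux_eq (T.image conicPt) (by
        intro p
        by_contra! h
        obtain ⟨a, ha, b, hb, c, hc, hab, hac, hbc⟩ := Finset.two_lt_card.mp h
        simp only [Finset.mem_filter, Finset.mem_image] at ha hb hc
        obtain ⟨⟨x, -, rfl⟩, ha⟩ := ha
        obtain ⟨⟨y, -, rfl⟩, hb⟩ := hb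
        obtain ⟨⟨z, -, rfl⟩, hc⟩ := hc
        exact conic_arc p x y z (fun h => hab (by rw [h])) (fun h => hac (by rw [h]))
          (fun h => hbc (by rw [h])) ha hb hc)
      rw [hc, hcard, ← cast] at this
      exact_mod_cast this.symm
  apply le_antisymm
  · exact Nat.sInf_le hmem
  · obtain ⟨R, hR, hn⟩ := Nat.sInf_mem ⟨_, hmem⟩
    have hf : fmin F r = (Podd F R).ncard := hn.symm
    rw [hf]
    have := aux_lower R.toFinset
    rw [← Set.ncard_eq_toFinset_card', hR, hcard, ← cast, Set.coe_toFinset] at this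
    exact_mod_cast this
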